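/- There exists a family of fine broadcast protocols B_n such that the minimal DFA recognizing L(B_n) has size exponential in the number of states of B_n. -/

import Mathlib

/-- A broadcast protocol: initial state, for each action a unique sending
transition `sendSrc a --a!!--> sendTgt a`, and for each action and state
exactly one receiving transition `s --a??--> recv a s`. -/
structure BP (S A : Type) where
  init : S
  sendSrc : A → S
  sendTgt : A → S
  recv : A → S → S

namespace BP

variable {S A : Type}

/-- Initial configuration of `B^n`: all `n` processes in the initial state. -/
def initConfig [DecidableEq S] (B : BP S A) (n : ℕ) : S → ℕ :=
  fun s => if s = B.init then n else 0

/-- Successor configuration on action `a`: the sender leaves `sendSrc a`,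
all other processes take their receiving transitions, and the sender
arrives at `sendTgt a`. -/
def succ [Fintype S] [DecidableEq S] (B : BP S A) (a : A) (q : S → ℕ) : S → ℕ :=
  fun s =>
    (∑ t : S, if B.recv a t = s then q t - (if t = B.sendSrc a then 1 else 0) else 0) +
      (if s = B.sendTgt a then 1 else 0)

/-- Run of the system from a configuration along a word (the reached
configuration does not depend on which lit process sends). -/
def runFrom [Fintype S] [DecidableEq S] (B : BP S A) : (S → ℕ) → List A → Option (S → ℕ)
  | q, [] => some q
  | q, a :: w => if 1 ≤ q (B.sendSrc a) then B.runFrom (B.succ a q) w else none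

/-- Configuration reached by `B^n` on word `w` (if `w` is feasible). -/
def cfg [Fintype S] [DecidableEq S] (B : BP S A) (n : ℕ) (w : List A) : Option (S → ℕ) :=
  B.runFrom (B.initConfig n) w

/-- `w` is feasible in `B^n`. -/
def Feasible [Fintype S] [DecidableEq S] (B : BP S A) (n : ℕ) (w : List A) : Prop :=
  (B.cfg n w).isSome

end BP

/-- `B` is fine: no hidden states and it has a cutoff. -/
def BP.Fine {S A : Type} [Fintype S] [DecidableEq S] (B : BP S A) : Prop :=
  (∀ s : S, ∃ a : A, B.sendSrc a = s) ∧
  ∃ c : ℕ, ∀ k, c < k → ∀ w : List A, B.Feasible k w ↔ B.Feasible c w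

namespace BP

variable {n : ℕ}

/-- The protocol storing a subset of `Fin n`: the action `inl i` inserts `i` (a process leaves the
reservoir `none` for `some i`, and any process already there returns to the reservoir), and the
action `inr i` deletes `i`. -/
def subsetBP (n : ℕ) : BP (Option (Fin n)) (Fin n ⊕ Fin n) where
  init := none
  sendSrc := Sum.elim (fun _ => none) some
  sendTgt := Sum.elim some (fun _ => none)
  recv := Sum.elim (fun i s => if s = some i then none else s) (fun _ s => s)

/-- The configuration of `k` processes storing the set `T`. -/
def subsetConfig (k : ℕ) (T : Finset (Fin n)) : Option (Fin n) → ℕ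
  | none => k - T.card
  | some i => if i ∈ T then 1 else 0

theorem subsetBP_succ_inl_some (i j : Fin n) (q : Option (Fin n) → ℕ) :
    (subsetBP n).succ (Sum.inl i) q (some j) = if j = i then 1 else q (some j) := by
  have h : ∀ x : Fin n, ((if x = i then none else some x) = some j) ↔ (x ≠ i ∧ x = j) := by
    intro x
    by_cases hx : x = i <;> simp [hx]
  by_cases hj : j = i
  · subst hj
    simp [succ, subsetBP]
  · simp only [succ, subsetBP, Fintype.sum_option, Sum.elim_inl, Option.some.injEq, h]
    rw [Finset.sum_eq_single j] <;> simp +contextual [hj]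

theorem subsetBP_succ_inl_none (i : Fin n) (q : Option (Fin n) → ℕ) :
    (subsetBP n).succ (Sum.inl i) q none = q none - 1 + q (some i) := by
  simp [succ, subsetBP, Fintype.sum_option]

theorem subsetBP_succ_inr_some (i j : Fin n) (q : Option (Fin n) → ℕ) :
    (subsetBP n).succ (Sum.inr i) q (some j) = if j = i then q (some j) - 1 else q (some j) := by
  by_cases hj : j = i <;> simp [succ, subsetBP, hj]

theorem subsetBP_succ_inr_none (i : Fin n) (q : Option (Fin n) → ℕ) :
    (subsetBP n).succ (Sum.inr i) q none = q none + 1 := by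
  simp [succ, subsetBP]

theorem succ_inl_subsetConfig {k : ℕ} {T : Finset (Fin n)} (hk : n < k) (i : Fin n) :
    (subsetBP n).succ (Sum.inl i) (subsetConfig k T) = subsetConfig k (insert i T) := by
  have hT : T.card ≤ n := by simpa using Finset.card_le_univ T
  funext s
  cases s with
  | none =>
    rw [subsetBP_succ_inl_none]
    by_cases hi : i ∈ T <;> simp [subsetConfig, hi] <;> omega
  | some j =>
    rw [subsetBP_succ_inl_some]
    by_cases hj : j = i <;> simp [subsetConfig, hj]

theorem succ_inr_subsetConfig {k : ℕ} {T : Finset (Fin n)} (hk : n < k) {i : Fin n}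
    (hi : i ∈ T) :
    (subsetBP n).succ (Sum.inr i) (subsetConfig k T) = subsetConfig k (T.erase i) := by
  have hT : T.card ≤ n := by simpa using Finset.card_le_univ T
  have hpos : 0 < T.card := Finset.card_pos.2 ⟨i, hi⟩
  funext s
  cases s with
  | none =>
    rw [subsetBP_succ_inr_none]
    simp [subsetConfig, hi]
    omega
  | some j =>
    rw [subsetBP_succ_inr_some]
    by_cases hj : j = i <;> simp [subsetConfig, hj, hi]

theorem initConfig_subsetBP (k : ℕ) : (subsetBP n).initConfig k = subsetConfig k ∅ := by
  funext s
  cases s <;> simp [initConfig, subsetBP, subsetConfig]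

theorem one_le_subsetConfig_none {k : ℕ} (hk : n < k) (T : Finset (Fin n)) :
    1 ≤ subsetConfig k T none := by
  have hT : T.card ≤ n := by simpa using Finset.card_le_univ T
  simp only [subsetConfig]
  omega

theorem runFrom_inl_cons {k : ℕ} (hk : n < k) (T : Finset (Fin n)) (i : Fin n)
    (w : List (Fin n ⊕ Fin n)) :
    (subsetBP n).runFrom (subsetConfig k T) (Sum.inl i :: w) =
      (subsetBP n).runFrom (subsetConfig k (insert i T)) w := by
  rw [runFrom, succ_inl_subsetConfig hk]
  exact if_pos (one_le_subsetConfig_none hk T)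

theorem runFrom_inr_cons {k : ℕ} (hk : n < k) (T : Finset (Fin n)) (i : Fin n)
    (w : List (Fin n ⊕ Fin n)) :
    (subsetBP n).runFrom (subsetConfig k T) (Sum.inr i :: w) =
      if i ∈ T then (subsetBP n).runFrom (subsetConfig k (T.erase i)) w else none := by
  by_cases hi : i ∈ T
  · rw [runFrom, succ_inr_subsetConfig hk hi]
    simp [subsetBP, subsetConfig, hi]
  · simp [runFrom, subsetBP, subsetConfig, hi]

theorem isSome_runFrom_subsetConfig_congr {k l : ℕ} (hk : n < k) (hl : n < l)
    (w : List (Fin n ⊕ Fin n)) (T : Finset (Fin n)) :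
    ((subsetBP n).runFrom (subsetConfig k T) w).isSome ↔
      ((subsetBP n).runFrom (subsetConfig l T) w).isSome := by
  induction w generalizing T with
  | nil => simp [runFrom]
  | cons a w ih =>
    cases a with
    | inl i =>
      rw [runFrom_inl_cons hk, runFrom_inl_cons hl]
      exact ih _
    | inr i =>
      rw [runFrom_inr_cons hk, runFrom_inr_cons hl]
      split_ifs
      · exact ih _
      · rfl

theorem fine_subsetBP (hn : 0 < n) : (subsetBP n).Fine := by
  refine ⟨fun s => ?_, n + 1, fun k hk w => ?_⟩
  · cases s with
    | none => exact ⟨Sum.inl ⟨0, hn⟩, rfl⟩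
    | some i => exact ⟨Sum.inr i, rfl⟩
  · simp only [Feasible, cfg, initConfig_subsetBP]
    exact isSome_runFrom_subsetConfig_congr (by omega) (by omega) w ∅

theorem isSome_runFrom_insertions_append {k : ℕ} (hk : n < k) (l : List (Fin n)) (j : Fin n)
    (T : Finset (Fin n)) (h : j ∈ T ∨ j ∈ l) :
    ((subsetBP n).runFrom (subsetConfig k T) (l.map Sum.inl ++ [Sum.inr j])).isSome := by
  induction l generalizing T with
  | nil =>
    have hj : j ∈ T := by simpa using h
    simp [runFrom_inr_cons hk, hj, runFrom]
  | cons i l ih =>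
    rw [List.map_cons, List.cons_append, runFrom_inl_cons hk]
    refine ih _ ?_
    simp only [Finset.mem_insert, List.mem_cons] at h ⊢
    tauto

theorem one_le_of_isSome_runFrom_insertions_append (l : List (Fin n)) (j : Fin n) (hj : j ∉ l)
    (q : Option (Fin n) → ℕ)
    (h : ((subsetBP n).runFrom q (l.map Sum.inl ++ [Sum.inr j])).isSome) : 1 ≤ q (some j) := by
  induction l generalizing q with
  | nil =>
    by_contra hq
    have hq' : ¬ 1 ≤ q ((subsetBP n).sendSrc (Sum.inr j)) := hq
    simp [runFrom, if_neg hq'] at h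
  | cons i l ih =>
    rw [List.mem_cons, not_or] at hj
    rw [List.map_cons, List.cons_append, runFrom] at h
    split_ifs at h
    · simpa [subsetBP_succ_inl_some, hj.1] using ih hj.2 _ h
    · simp at h

theorem exists_feasible_insertions_append_iff (l : List (Fin n)) (j : Fin n) :
    (∃ k, (subsetBP n).Feasible k (l.map Sum.inl ++ [Sum.inr j])) ↔ j ∈ l := by
  simp only [Feasible, cfg, initConfig_subsetBP]
  refine ⟨fun ⟨k, hk⟩ => ?_, fun h => ⟨n + 1, ?_⟩⟩
  · by_contra hj
    simpa [subsetConfig] using one_le_of_isSome_runFrom_insertions_append l j hj _ hk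
  · exact isSome_runFrom_insertions_append (Nat.lt_succ_self n) l j ∅ (Or.inr h)

theorem two_pow_le_card_of_accepts_subsetBP {Q : Type} [Fintype Q] (M : DFA (Fin n ⊕ Fin n) Q)
    (hM : ∀ w, w ∈ M.accepts ↔ ∃ k, (subsetBP n).Feasible k w) : 2 ^ n ≤ Fintype.card Q := by
  let f : Finset (Fin n) → Q := fun T => M.eval (T.toList.map Sum.inl)
  have hf : ∀ T j, M.step (f T) (Sum.inr j) ∈ M.accept ↔ j ∈ T := by
    intro T j
    rw [← Finset.mem_toList, ← exists_feasible_insertions_append_iff, ← hM, DFA.mem_accepts,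
      DFA.eval_append_singleton]
  have hinj : Function.Injective f := by
    intro T U h
    ext j
    rw [← hf, h, hf]
  simpa using Fintype.card_le_of_injective f hinj

end BP

/-- there is a family of fine BPs `B_n` with at most `n²` states
such that every DFA recognizing `L(B_n)` has at least `2^{c·n/log n}` states;
i.e., the minimal DFA is of size exponential in the size of the BP. -/
theorem exists_fine_BP_family_exponential_DFA :
    ∃ c : ℝ, 0 < c ∧ ∀ᶠ n : ℕ in Filter.atTop,
      ∃ (S A : Type) (iS : Fintype S) (dS : DecidableEq S) (_ : Fintype A)
        (B : BP S A),
        @BP.Fine S A iS dS B ∧ Fintype.card S ≤ n ^ 2 ∧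
        ∀ (Q : Type) (_ : Fintype Q) (M : DFA A Q),
          (∀ w : List A, w ∈ M.accepts ↔ ∃ k, @BP.Feasible S A iS dS B k w) →
          (2 : ℝ) ^ (c * n / Real.log n) ≤ (Fintype.card Q : ℝ) := by
  refine ⟨1, one_pos, ?_⟩
  filter_upwards [Filter.eventually_ge_atTop 3] with n hn
  refine ⟨Option (Fin n), Fin n ⊕ Fin n, inferInstance, inferInstance, inferInstance,
    BP.subsetBP n, BP.fine_subsetBP (by omega), ?_, fun Q _ M hM => ?_⟩
  · simp only [Fintype.card_option, Fintype.card_fin]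
    nlinarith
  · have hn' : (3 : ℝ) ≤ n := by exact_mod_cast hn
    have hlog : 1 ≤ Real.log n := by
      rw [Real.le_log_iff_exp_le (by linarith)]
      linarith [Real.exp_one_lt_d9]
    calc (2 : ℝ) ^ (1 * n / Real.log n) ≤ (2 : ℝ) ^ (n : ℝ) := by
          apply Real.rpow_le_rpow_of_exponent_le one_le_two
          rw [one_mul]
          exact div_le_self (by linarith) hlog
      _ = ((2 ^ n : ℕ) : ℝ) := by
          rw [Real.rpow_natCast]
          norm_cast
      _ ≤ (Fintype.card Q : ℝ) := by
          exact_mod_cast BP.two_pow_le_card_of_accepts_subsetBP M hM
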